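/- Let n ≥ 2 and σ > 0, and let f ∈ ℂ[z₁,…,z_n] be a nonzero polynomial. Then for every finite Borel probability measure μ supported on the zero set Z(f) ∩ B, where B is any closed ball in ℂⁿ, the energy I(μ) = ∬ k_σ(z, ξ) dμ(z) dμ(ξ) with kernel k_σ(z,ξ) = |log‖z−ξ‖|^σ / ‖z−ξ‖^{2n−2} is infinite; equivalently, C_σ(Z(f) ∩ B) = 0. -/

import Mathlib

open MeasureTheory
open scoped ENNReal

noncomputable instance (n : ℕ) : MeasurableSpace (EuclideanSpace ℂ (Fin n)) := borel _

instance (n : ℕ) : BorelSpace (EuclideanSpace ℂ (Fin n)) := ⟨rfl⟩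

/- The kernel `k_σ(z,ξ) = |log‖z−ξ‖|^σ / ‖z−ξ‖^{2n−2}`, with value `⊤` on the diagonal. -/
open scoped Classical in
noncomputable def capacityKernel (n : ℕ) (σ : ℝ)
    (z ξ : EuclideanSpace ℂ (Fin n)) : ℝ≥0∞ :=
  if z = ξ then ⊤ else ENNReal.ofReal (|Real.log ‖z - ξ‖| ^ σ / ‖z - ξ‖ ^ (2 * n - 2))


/-- A monic polynomial without zeros in a disc of radius `ρ` around `0` is nearly constant near
`0`, stated for the product over its multiset of roots. -/
lemma norm_prod_sub_sub_prod_sub_le {ρ : ℝ} (hρ : 0 < ρ) (t : ℂ) (s : Multiset ℂ)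
    (hs : ∀ r ∈ s, ρ ≤ ‖r‖) :
    ‖(s.map fun r => t - r).prod - (s.map fun r => 0 - r).prod‖ ≤
      ((1 + ‖t‖ / ρ) ^ Multiset.card s - 1) * ‖(s.map fun r => 0 - r).prod‖ := by
  induction s using Multiset.induction_on with
  | empty => simp
  | cons a s ih =>
    have ih := ih fun r hr => hs r (Multiset.mem_cons_of_mem hr)
    have ha : ρ ≤ ‖a‖ := hs a (Multiset.mem_cons_self a s)
    simp only [Multiset.map_cons, Multiset.prod_cons, Multiset.card_cons]
    set P := (s.map fun r => t - r).prod
    set Q := (s.map fun r => 0 - r).prod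
    set u := (1 + ‖t‖ / ρ)
    have hta : ‖t‖ ≤ ‖t‖ / ρ * ‖a‖ := by
      rw [div_mul_eq_mul_div, le_div_iff₀ hρ]
      gcongr
    have h1 : ‖t - a‖ ≤ u * ‖a‖ := by
      have := norm_sub_le t a
      simp only [u]
      linarith
    have hu : 0 ≤ u := by positivity
    have key : (t - a) * P - (0 - a) * Q = (t - a) * (P - Q) + t * Q := by ring
    have hQ := norm_nonneg Q
    calc ‖(t - a) * P - (0 - a) * Q‖ ≤ ‖t - a‖ * ‖P - Q‖ + ‖t‖ * ‖Q‖ := by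
          rw [key, ← norm_mul, ← norm_mul]
          exact norm_add_le _ _
      _ ≤ u * ‖a‖ * ((u ^ Multiset.card s - 1) * ‖Q‖) + ‖t‖ / ρ * ‖a‖ * ‖Q‖ := by
          gcongr
      _ = (u ^ (Multiset.card s + 1) - 1) * ‖(0 - a) * Q‖ := by
          rw [norm_mul, zero_sub, norm_neg]
          simp only [u]
          ring

open Polynomial in
lemma norm_eval_sub_eval_zero_le {ρ : ℝ} (hρ : 0 < ρ) {d : ℕ} (p : ℂ[X])
    (hd : p.natDegree ≤ d) (hp : ∀ z : ℂ, ‖z‖ ≤ ρ → p.eval z ≠ 0) (t : ℂ) :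
    ‖p.eval t - p.eval 0‖ ≤ ((1 + ‖t‖ / ρ) ^ d - 1) * ‖p.eval 0‖ := by
  have hev : ∀ z : ℂ, p.eval z = p.leadingCoeff * (p.roots.map fun r => z - r).prod := by
    intro z
    conv_lhs => rw [(IsAlgClosed.splits p).eq_prod_roots]
    rw [eval_mul, eval_C, eval_multiset_prod, Multiset.map_map]
    simp
  have hroots : ∀ r ∈ p.roots, ρ ≤ ‖r‖ := by
    intro r hr
    by_contra! hlt
    exact hp r hlt.le (mem_roots'.1 hr).2
  have hmain := norm_prod_sub_sub_prod_sub_le hρ t p.roots hroots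
  have hcard : Multiset.card p.roots ≤ d := p.card_roots'.trans hd
  have hone : 1 ≤ 1 + ‖t‖ / ρ := by
    have : 0 ≤ ‖t‖ / ρ := by positivity
    linarith
  have hpow := pow_le_pow_right₀ hone hcard
  rw [hev t, hev 0, ← mul_sub, norm_mul, norm_mul]
  calc _ ≤ ‖p.leadingCoeff‖ * (((1 + ‖t‖ / ρ) ^ d - 1) *
        ‖(p.roots.map fun r => 0 - r).prod‖) := by
        gcongr
        exact hmain.trans (by gcongr)
    _ = _ := by ring

open Polynomial in
/-- Stability of Lagrange interpolation: a polynomial of degree at most `d` that is close to a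
constant at `d + 1` separated nodes is close to that constant near the nodes. -/
lemma norm_eval_sub_le_of_nodes {d : ℕ} (p : ℂ[X]) (hd : p.natDegree ≤ d) (q : ℕ → ℂ)
    {δ M η : ℝ} (hδ : 0 < δ) (c w : ℂ)
    (hsep : ∀ k l, k ≠ l → δ ≤ ‖q k - q l‖)
    (hw : ∀ k ≤ d, ‖w - q k‖ ≤ M * δ) (hc : ∀ k ≤ d, ‖p.eval (q k) - c‖ ≤ η) :
    ‖p.eval w - c‖ ≤ (d + 1) * (M ^ d * η) := by
  classical
  have hM : 0 ≤ M := by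
    have := (norm_nonneg _).trans (hw 0 (Nat.zero_le d))
    exact nonneg_of_mul_nonneg_left this hδ
  have hinj : Set.InjOn q (Finset.range (d + 1) : Set ℕ) := by
    intro k _ l _ hkl
    by_contra hne
    have := hsep k l hne
    rw [hkl, sub_self, norm_zero] at this
    linarith
  have hdeg : (p - C c).degree < ((Finset.range (d + 1)).card : WithBot ℕ) := by
    rw [Finset.card_range]
    refine lt_of_le_of_lt degree_le_natDegree ?_
    rw [natDegree_sub_C]
    exact_mod_cast Nat.lt_succ_of_le hd
  have hint := Lagrange.eq_interpolate hinj hdeg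
  have hval : p.eval w - c = ∑ i ∈ Finset.range (d + 1),
      (p.eval (q i) - c) * (Lagrange.basis (Finset.range (d + 1)) q i).eval w := by
    have := congrArg (eval w) hint
    rw [Lagrange.interpolate_apply, eval_finsetSum] at this
    simpa using this
  have hbasis : ∀ i ∈ Finset.range (d + 1),
      ‖(Lagrange.basis (Finset.range (d + 1)) q i).eval w‖ ≤ M ^ d := by
    intro i hi
    rw [Lagrange.basis, eval_prod, norm_prod]
    have hcard : ((Finset.range (d + 1)).erase i).card = d := by
      rw [Finset.card_erase_of_mem hi, Finset.card_range, Nat.add_sub_cancel]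
    refine (Finset.prod_le_prod (fun j _ => norm_nonneg _) fun j hj => ?_).trans_eq
      ((Finset.prod_const M).trans (by rw [hcard]))
    obtain ⟨hji, hj⟩ := Finset.mem_erase.1 hj
    have h1 := hsep i j hji.symm
    have h2 := hw j (Nat.lt_succ_iff.1 (Finset.mem_range.1 hj))
    simp only [Lagrange.basisDivisor, eval_mul, eval_C, eval_sub, eval_X, norm_mul, norm_inv]
    rw [inv_mul_le_iff₀ (hδ.trans_le h1), mul_comm]
    exact h2.trans (by gcongr)
  rw [hval]
  calc _ ≤ ∑ _i ∈ Finset.range (d + 1), η * M ^ d := by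
        refine norm_sum_le_of_le _ fun i hi => ?_
        rw [norm_mul]
        have := hc i (Nat.lt_succ_iff.1 (Finset.mem_range.1 hi))
        have h0 := (norm_nonneg _).trans this
        exact mul_le_mul this (hbasis i hi) (norm_nonneg _) h0
    _ = _ := by
        rw [Finset.sum_const, Finset.card_range, nsmul_eq_mul]
        push_cast
        ring

/-- Functions on `ℂⁿ` whose restriction to every complex line is a polynomial of degree at
most `d`. -/
def IsPolyOnLines {n : ℕ} (d : ℕ) (F : (Fin n → ℂ) → ℂ) : Prop :=
  ∀ x v : Fin n → ℂ, ∃ p : Polynomial ℂ, p.natDegree ≤ d ∧ ∀ t : ℂ, F (x + t • v) = p.eval t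

lemma Fin.cons_add_smul_cons {n : ℕ} (a b t : ℂ) (x y : Fin n → ℂ) :
    (Fin.cons (a + t * b) (x + t • y) : Fin (n + 1) → ℂ) = Fin.cons a x + t • Fin.cons b y := by
  ext i
  refine Fin.cases ?_ (fun j => ?_) i <;> simp

lemma Fin.norm_cons_sub_cons_le {n : ℕ} {a b : ℂ} {x y : Fin n → ℂ} {r : ℝ}
    (hab : ‖a - b‖ ≤ r) (hxy : ‖x - y‖ ≤ r) :
    ‖(Fin.cons a x : Fin (n + 1) → ℂ) - Fin.cons b y‖ ≤ r := by
  rw [pi_norm_le_iff_of_nonneg ((norm_nonneg _).trans hab)]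
  refine Fin.cases ?_ fun j => ?_
  · simpa using hab
  · simpa using (norm_le_pi_norm (x - y) j).trans hxy

lemma IsPolyOnLines.cons {n d : ℕ} {F : (Fin (n + 1) → ℂ) → ℂ} (hF : IsPolyOnLines d F) (a : ℂ) :
    IsPolyOnLines d fun x : Fin n → ℂ => F (Fin.cons a x) := by
  intro x v
  obtain ⟨p, hd, hp⟩ := hF (Fin.cons a x) (Fin.cons 0 v)
  refine ⟨p, hd, fun t => ?_⟩
  rw [← hp, ← Fin.cons_add_smul_cons]
  simp

lemma IsPolyOnLines.exists_cons_eq_eval {n d : ℕ} {F : (Fin (n + 1) → ℂ) → ℂ}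
    (hF : IsPolyOnLines d F) (y : Fin n → ℂ) :
    ∃ p : Polynomial ℂ, p.natDegree ≤ d ∧ ∀ t : ℂ, F (Fin.cons t y) = p.eval t := by
  obtain ⟨p, hd, hp⟩ := hF (Fin.cons 0 y) (Fin.cons 1 0)
  refine ⟨p, hd, fun t => ?_⟩
  rw [← hp, ← Fin.cons_add_smul_cons]
  simp

lemma IsPolyOnLines.norm_add_sub_le {n d : ℕ} {F : (Fin n → ℂ) → ℂ} (hF : IsPolyOnLines d F)
    {x v : Fin n → ℂ} {ρ : ℝ} (hρ : 0 < ρ) (h : ∀ t : ℂ, ‖t‖ ≤ ρ → F (x + t • v) ≠ 0) :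
    ‖F (x + v) - F x‖ ≤ ((1 + 1 / ρ) ^ d - 1) * ‖F x‖ := by
  obtain ⟨p, hd, hp⟩ := hF x v
  have := norm_eval_sub_eval_zero_le hρ p hd (fun z hz => hp z ▸ h z hz) 1
  rw [← hp, ← hp] at this
  simpa using this

/-- Every disc contains a slice `a` such that `F (a, ·)` does not vanish identically. -/
lemma IsPolyOnLines.exists_slice_ne_zero {n d : ℕ} {F : (Fin (n + 1) → ℂ) → ℂ}
    (hF : IsPolyOnLines d F) (h0 : ∃ z, F z ≠ 0) {δ : ℝ} (hδ : 0 < δ) (a : ℂ) :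
    ∃ b : ℂ, ‖b - a‖ ≤ δ ∧ ∃ x : Fin n → ℂ, F (Fin.cons b x) ≠ 0 := by
  obtain ⟨z, hz⟩ := h0
  obtain ⟨p, -, hp⟩ := hF.exists_cons_eq_eval (Fin.tail z)
  have hp0 : p ≠ 0 := by
    rintro rfl
    apply hz
    rw [← Fin.cons_self_tail z, hp, Polynomial.eval_zero]
  have hinf : (Metric.ball a δ).Infinite :=
    infinite_of_mem_nhds a (Metric.ball_mem_nhds a hδ)
  obtain ⟨b, hb, hbr⟩ := hinf.exists_notMem_finset p.roots.toFinset
  refine ⟨b, (mem_ball_iff_norm.1 hb).le, Fin.tail z, fun h => hbr ?_⟩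
  rw [Multiset.mem_toFinset, Polynomial.mem_roots hp0, Polynomial.IsRoot, ← hp, h]

lemma exists_finset_cover_complex (R : ℝ) :
    ∃ C : ℝ, 0 ≤ C ∧ ∀ δ : ℝ, 0 < δ → δ ≤ 1 → ∃ S : Finset ℂ, (S.card : ℝ) * δ ^ 2 ≤ C ∧
      ∀ z : ℂ, ‖z‖ ≤ R → ∃ s ∈ S, ‖z - s‖ ≤ δ := by
  classical
  refine ⟨(2 * |R| + 5) ^ 2, by positivity, fun δ hδ hδ1 => ?_⟩
  set m : ℕ := ⌈|R| / δ⌉₊ + 1 with hm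
  let I : Finset ℤ := Finset.Icc (-(m : ℤ)) m
  have hI : I.card = 2 * m + 1 := by
    simp only [I, Int.card_Icc]
    omega
  have hmδ : m * δ ≤ |R| + 2 := by
    have h1 := (Nat.ceil_lt_add_one (show 0 ≤ |R| / δ by positivity)).le
    have h2 : (m : ℝ) ≤ |R| / δ + 2 := by
      rw [hm]
      push_cast
      linarith
    calc m * δ ≤ (|R| / δ + 2) * δ := by gcongr
      _ = |R| + 2 * δ := by field_simp
      _ ≤ |R| + 2 := by linarith
  refine ⟨(I ×ˢ I).image fun k => ⟨δ * k.1, δ * k.2⟩, ?_, fun z hz => ?_⟩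
  · calc _ ≤ ((I ×ˢ I).card : ℝ) * δ ^ 2 := by
          gcongr
          exact Finset.card_image_le
      _ = (2 * (m * δ) + δ) ^ 2 := by
          rw [Finset.card_product, hI]
          push_cast
          ring
      _ ≤ _ := by
          refine pow_le_pow_left₀ (by positivity) ?_ 2
          linarith
  · have hround : ∀ x : ℝ, |x| ≤ R → round (x / δ) ∈ I ∧ |x - δ * round (x / δ)| ≤ δ / 2 := by
      intro x hx
      have h1 := abs_sub_round (x / δ)
      have h2 : |x / δ| ≤ |R| / δ := by
        rw [abs_div, abs_of_pos hδ]
        exact div_le_div_of_nonneg_right (hx.trans (le_abs_self R)) hδ.le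
      have h3 := Nat.le_ceil (|R| / δ)
      rw [abs_le] at h1 h2
      constructor
      · rw [Finset.mem_Icc]
        constructor
        · have : -(m : ℝ) ≤ round (x / δ) := by
            rw [hm]; push_cast; linarith
          exact_mod_cast this
        · have : (round (x / δ) : ℝ) ≤ m := by
            rw [hm]; push_cast; linarith
          exact_mod_cast this
      · have : x - δ * round (x / δ) = δ * (x / δ - round (x / δ)) := by field_simp
        rw [this, abs_mul, abs_of_pos hδ]
        nlinarith [abs_sub_round (x / δ)]
    obtain ⟨hr, hr'⟩ := hround z.re ((Complex.abs_re_le_norm z).trans hz)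
    obtain ⟨hi, hi'⟩ := hround z.im ((Complex.abs_im_le_norm z).trans hz)
    refine ⟨_, Finset.mem_image.2 ⟨(round (z.re / δ), round (z.im / δ)),
      Finset.mk_mem_product hr hi, rfl⟩, ?_⟩
    refine (Complex.norm_le_abs_re_add_abs_im _).trans ?_
    simp only [Complex.sub_re, Complex.sub_im]
    linarith

lemma exists_finset_cover_pi (n : ℕ) (R : ℝ) :
    ∃ C : ℝ, 0 ≤ C ∧ ∀ δ : ℝ, 0 < δ → δ ≤ 1 → ∃ S : Finset (Fin n → ℂ),
      (S.card : ℝ) * δ ^ (2 * n) ≤ C ∧ ∀ z : Fin n → ℂ, ‖z‖ ≤ R → ∃ s ∈ S, ‖z - s‖ ≤ δ := by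
  classical
  induction n with
  | zero =>
    refine ⟨1, by norm_num, fun δ hδ _ => ⟨{0}, by simp, fun z _ => ⟨0, by simp, ?_⟩⟩⟩
    rw [Subsingleton.elim z 0, sub_self, norm_zero]
    exact hδ.le
  | succ n ih =>
    obtain ⟨C, hC, h⟩ := ih
    obtain ⟨C', hC', h'⟩ := exists_finset_cover_complex R
    refine ⟨C' * C, by positivity, fun δ hδ hδ1 => ?_⟩
    obtain ⟨S, hS, hcov⟩ := h δ hδ hδ1
    obtain ⟨S', hS', hcov'⟩ := h' δ hδ hδ1
    refine ⟨(S' ×ˢ S).image fun q => Fin.cons q.1 q.2, ?_, fun z hz => ?_⟩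
    · calc _ ≤ ((S' ×ˢ S).card : ℝ) * δ ^ (2 * (n + 1)) := by
            gcongr
            exact Finset.card_image_le
        _ = (S'.card * δ ^ 2) * (S.card * δ ^ (2 * n)) := by
            rw [Finset.card_product]
            push_cast
            ring
        _ ≤ _ := by gcongr
    · obtain ⟨a, ha, hza⟩ := hcov' (z 0) ((norm_le_pi_norm z 0).trans hz)
      have htail : ‖Fin.tail z‖ ≤ R := by
        rw [pi_norm_le_iff_of_nonneg ((norm_nonneg _).trans hz)]
        exact fun i => (norm_le_pi_norm z i.succ).trans hz
      obtain ⟨s, hs, hzs⟩ := hcov (Fin.tail z) htail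
      refine ⟨_, Finset.mem_image.2 ⟨(a, s), Finset.mk_mem_product ha hs, rfl⟩, ?_⟩
      rw [← Fin.cons_self_tail z]
      exact Fin.norm_cons_sub_cons_le hza hzs

/-- If `F` is nonzero along sufficiently long pieces of `d + 1` parallel slices near `w` and of one
transversal line, then `F (w, y + v)` is nonzero. -/
lemma IsPolyOnLines.ne_zero_of_slices {n d : ℕ} {F : (Fin (n + 1) → ℂ) → ℂ}
    (hF : IsPolyOnLines d F) {q : ℕ → ℂ} {δ M ρ : ℝ} (hδ : 0 < δ) (hρ : 0 < ρ)
    (hsmall : 3 * ((d + 1) * M ^ d * ((1 + 1 / ρ) ^ d - 1)) < 1)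
    (hsmall' : (1 + 1 / ρ) ^ d - 1 ≤ 1) (w : ℂ) (y v : Fin n → ℂ)
    (hsep : ∀ k l, k ≠ l → δ ≤ ‖q k - q l‖) (hw : ∀ k ≤ d, ‖w - q k‖ ≤ M * δ)
    (hline : ∀ k ≤ d, ∀ t : ℂ, ‖t‖ ≤ ρ → F (Fin.cons (q 0 + t * (q k - q 0)) y) ≠ 0)
    (hslice : ∀ k ≤ d, ∀ t : ℂ, ‖t‖ ≤ ρ → F (Fin.cons (q k) (y + t • v)) ≠ 0) :
    F (Fin.cons w (y + v)) ≠ 0 := by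
  intro hzero
  set ε := (1 + 1 / ρ) ^ d - 1 with hε
  have hε0 : 0 ≤ ε := by
    have : (1 : ℝ) ≤ 1 + 1 / ρ := by
      have : 0 ≤ 1 / ρ := by positivity
      linarith
    have := one_le_pow₀ this (n := d)
    linarith
  set c := F (Fin.cons (q 0) y) with hc
  have hc0 : 0 < ‖c‖ := by
    have := hline 0 (Nat.zero_le d) 0 (by simpa using hρ.le)
    rw [zero_mul, add_zero] at this
    exact norm_pos_iff.2 this
  have hnode : ∀ k ≤ d, ‖F (Fin.cons (q k) (y + v)) - c‖ ≤ 3 * ε * ‖c‖ := by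
    intro k hk
    have h1 : ‖F (Fin.cons (q k) y) - c‖ ≤ ε * ‖c‖ := by
      have := hF.norm_add_sub_le (x := Fin.cons (q 0) y) (v := Fin.cons (q k - q 0) 0) hρ
        fun t ht => by
          rw [← Fin.cons_add_smul_cons, smul_zero, add_zero]
          exact hline k hk t ht
      have hadd : (Fin.cons (q 0) y : Fin (n + 1) → ℂ) + Fin.cons (q k - q 0) 0 =
          Fin.cons (q k) y := by
        have := Fin.cons_add_smul_cons (q 0) (q k - q 0) 1 y 0
        simpa using this.symm
      rwa [hadd] at this
    have h2 := (hF.cons (q k)).norm_add_sub_le hρ (hslice k hk)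
    have h3 : ‖F (Fin.cons (q k) y)‖ ≤ 2 * ‖c‖ := by
      have := norm_le_insert' (F (Fin.cons (q k) y)) c
      nlinarith
    calc _ ≤ ‖F (Fin.cons (q k) (y + v)) - F (Fin.cons (q k) y)‖ +
          ‖F (Fin.cons (q k) y) - c‖ := norm_sub_le_norm_sub_add_norm_sub _ _ _
      _ ≤ ε * (2 * ‖c‖) + ε * ‖c‖ := by
          gcongr
          exact h2.trans (by gcongr)
      _ = _ := by ring
  obtain ⟨p, hd, hp⟩ := hF.exists_cons_eq_eval (y + v)
  have := norm_eval_sub_le_of_nodes p hd q hδ c w hsep hw fun k hk => by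
    rw [← hp]
    exact hnode k hk
  rw [← hp, hzero, zero_sub, norm_neg] at this
  nlinarith

lemma exists_pow_sub_one_lt (d : ℕ) {η : ℝ} (hη : 0 < η) :
    ∃ ρ : ℝ, 1 ≤ ρ ∧ (1 + 1 / ρ) ^ d - 1 < η := by
  have : Filter.Tendsto (fun ρ : ℝ => (1 + 1 / ρ) ^ d - 1) Filter.atTop (nhds 0) := by
    have h : Filter.Tendsto (fun ρ : ℝ => 1 / ρ) Filter.atTop (nhds 0) := by
      simpa using tendsto_inv_atTop_zero (𝕜 := ℝ)
    simpa using ((h.const_add 1).pow d).sub_const 1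
  exact ((Filter.eventually_ge_atTop 1).and (this.eventually_lt_const hη)).exists

/-- The part in a fixed ball of the zero set of a nonzero function that is polynomial of degree at
most `d` on lines is covered by `O(δ ^ (2 - 2 * n))` balls of radius `O(δ)`. -/
theorem IsPolyOnLines.exists_finset_cover_zeros (n d : ℕ) (R : ℝ) :
    ∃ C K : ℝ, 0 ≤ C ∧ 0 ≤ K ∧ ∀ F : (Fin n → ℂ) → ℂ, IsPolyOnLines d F → (∃ z, F z ≠ 0) →
      ∀ δ : ℝ, 0 < δ → δ ≤ 1 → ∃ S : Finset (Fin n → ℂ),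
        (S.card : ℝ) * δ ^ (2 * n) ≤ C * δ ^ 2 ∧
        ∀ z, F z = 0 → ‖z‖ ≤ R → ∃ s ∈ S, ‖z - s‖ ≤ K * δ := by
  classical
  induction n generalizing R with
  | zero =>
    refine ⟨0, 0, le_rfl, le_rfl, fun F _ ⟨w, hw⟩ δ _ _ => ⟨∅, by simp, fun z hz _ => ?_⟩⟩
    exact absurd (Subsingleton.elim z w ▸ hz) hw
  | succ n ih =>
    set M : ℝ := 3 * d + 2 with hM
    have hM0 : 0 < M := by positivity
    obtain ⟨ρ, hρ1, hρ⟩ := exists_pow_sub_one_lt d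
      (show 0 < min 1 (1 / (3 * ((d + 1) * M ^ d))) by positivity)
    have hsmall' : (1 + 1 / ρ) ^ d - 1 ≤ 1 := hρ.le.trans (min_le_left _ _)
    have hsmall : 3 * ((d + 1) * M ^ d * ((1 + 1 / ρ) ^ d - 1)) < 1 := by
      have := hρ.trans_le (min_le_right _ _)
      rw [lt_div_iff₀ (by positivity)] at this
      linarith
    set A : ℝ := 2 * M * ρ + M with hA
    have hA0 : 0 ≤ A := by positivity
    obtain ⟨C₀, K₀, hC₀, hK₀, ih⟩ := ih (R + A)
    obtain ⟨C₁, hC₁, hcov₁⟩ := exists_finset_cover_complex R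
    obtain ⟨C₂, hC₂, hcov₂⟩ := exists_finset_cover_pi n R
    refine ⟨C₁ * (d + 1) * C₀ + C₂ * d, A + K₀ + 1, by positivity, by positivity,
      fun F hF h0 δ hδ hδ1 => ?_⟩
    obtain ⟨S₁, hS₁, hcov₁⟩ := hcov₁ δ hδ hδ1
    obtain ⟨S₂, hS₂, hcov₂⟩ := hcov₂ δ hδ hδ1
    choose g hg hg0 using hF.exists_slice_ne_zero h0 hδ
    choose T hT hTcov using fun a => ih (fun x => F (Fin.cons (g a) x)) (hF.cons _) (hg0 a) δ hδ hδ1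
    choose p hpd hp using hF.exists_cons_eq_eval
    let a : ℂ × ℕ → ℂ := fun k => k.1 + ((3 * k.2 * δ : ℝ) : ℂ)
    let U₁ : Finset (Fin (n + 1) → ℂ) := (S₁ ×ˢ Finset.range (d + 1)).biUnion fun k =>
      (T (a k)).image fun s => Fin.cons (g (a k)) s
    let U₂ : Finset (Fin (n + 1) → ℂ) := S₂.biUnion fun y =>
      (p y).roots.toFinset.image fun t => Fin.cons t y
    refine ⟨U₁ ∪ U₂, ?_, fun z hz hzR => ?_⟩
    · have hU₁ : (U₁.card : ℝ) * δ ^ (2 * n) ≤ S₁.card * (d + 1) * (C₀ * δ ^ 2) := by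
        have h1 : (U₁.card : ℝ) ≤ ∑ k ∈ S₁ ×ˢ Finset.range (d + 1), ((T (a k)).card : ℝ) := by
          refine (Nat.cast_le.2 Finset.card_biUnion_le).trans ?_
          push_cast
          gcongr
          exact Finset.card_image_le
        calc _ ≤ (∑ k ∈ S₁ ×ˢ Finset.range (d + 1), ((T (a k)).card : ℝ)) * δ ^ (2 * n) := by
              gcongr
          _ ≤ ∑ k ∈ S₁ ×ˢ Finset.range (d + 1), C₀ * δ ^ 2 := by
              rw [Finset.sum_mul]
              exact Finset.sum_le_sum fun k _ => hT (a k)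
          _ = _ := by
              rw [Finset.sum_const, Finset.card_product, Finset.card_range, nsmul_eq_mul]
              push_cast
              ring
      have hU₂ : (U₂.card : ℝ) ≤ S₂.card * d := by
        have : U₂.card ≤ S₂.card * d := Finset.card_biUnion_le_card_mul _ _ _ fun y _ =>
          Finset.card_image_le.trans <| (Multiset.toFinset_card_le _).trans <|
            ((p y).card_roots').trans (hpd y)
        exact_mod_cast this
      calc ((U₁ ∪ U₂).card : ℝ) * δ ^ (2 * (n + 1))
          ≤ (U₁.card + U₂.card) * δ ^ (2 * (n + 1)) := by
            gcongr
            exact_mod_cast Finset.card_union_le _ _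
        _ = (U₁.card * δ ^ (2 * n)) * δ ^ 2 + U₂.card * (δ ^ (2 * n) * δ ^ 2) := by ring
        _ ≤ (S₁.card * (d + 1) * (C₀ * δ ^ 2)) * δ ^ 2 +
            (S₂.card * d) * (δ ^ (2 * n) * δ ^ 2) := by gcongr
        _ = (S₁.card * δ ^ 2) * (d + 1) * C₀ * δ ^ 2 + (S₂.card * δ ^ (2 * n)) * d * δ ^ 2 := by
            ring
        _ ≤ C₁ * (d + 1) * C₀ * δ ^ 2 + C₂ * d * δ ^ 2 := by gcongr
        _ = _ := by ring
    · by_contra! hfar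
      set w := z 0
      set x := Fin.tail z
      have hzc : z = Fin.cons w x := (Fin.cons_self_tail z).symm
      have hxR : ‖x‖ ≤ R := by
        rw [pi_norm_le_iff_of_nonneg ((norm_nonneg _).trans hzR)]
        exact fun i => (norm_le_pi_norm z i.succ).trans hzR
      obtain ⟨b, hb, hwb⟩ := hcov₁ w ((norm_le_pi_norm z 0).trans hzR)
      obtain ⟨y, hy, hxy⟩ := hcov₂ x hxR
      set q : ℕ → ℂ := fun k => g (a (b, k)) with hq
      have hga : ∀ k, ‖q k - (b + ((3 * k * δ : ℝ) : ℂ))‖ ≤ δ := fun k => hg (a (b, k))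
      have hwq : ∀ k ≤ d, ‖w - q k‖ ≤ M * δ := by
        intro k hk
        have hk' : (k : ℝ) ≤ d := by exact_mod_cast hk
        have e : w - q k = (w - b) - (q k - (b + ((3 * k * δ : ℝ) : ℂ))) -
          ((3 * k * δ : ℝ) : ℂ) := by ring
        have h3 : ‖((3 * k * δ : ℝ) : ℂ)‖ = 3 * k * δ := by
          rw [Complex.norm_real, Real.norm_of_nonneg (by positivity)]
        rw [e]
        refine (norm_sub_le _ _).trans ?_
        rw [h3]
        have := norm_sub_le (w - b) (q k - (b + ((3 * k * δ : ℝ) : ℂ)))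
        have h4 := hga k
        rw [hM]
        nlinarith
      have hsep : ∀ k l, k ≠ l → δ ≤ ‖q k - q l‖ := by
        intro k l hkl
        have e : ((3 * (k - l) * δ : ℝ) : ℂ) = (q k - q l) -
            ((q k - (b + ((3 * k * δ : ℝ) : ℂ))) - (q l - (b + ((3 * l * δ : ℝ) : ℂ)))) := by
          push_cast
          ring
        have h1 : 3 * δ ≤ ‖((3 * (k - l) * δ : ℝ) : ℂ)‖ := by
          have : (1 : ℝ) ≤ |(k : ℝ) - l| := by
            have : (1 : ℤ) ≤ |(k : ℤ) - l| := Int.one_le_abs (by omega)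
            exact_mod_cast this
          rw [Complex.norm_real, Real.norm_eq_abs, abs_mul, abs_mul, abs_of_pos hδ,
            abs_of_pos (show (0 : ℝ) < 3 by norm_num)]
          nlinarith
        rw [e] at h1
        have h2 := norm_sub_le (q k - q l)
          ((q k - (b + ((3 * k * δ : ℝ) : ℂ))) - (q l - (b + ((3 * l * δ : ℝ) : ℂ))))
        have h3 := norm_sub_le (q k - (b + ((3 * k * δ : ℝ) : ℂ)))
          (q l - (b + ((3 * l * δ : ℝ) : ℂ)))
        linarith [hga k, hga l]
      have hMA : M ≤ A := by
        rw [hA]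
        have : 0 ≤ 2 * M * ρ := by positivity
        linarith
      have hslice : ∀ k ≤ d, ∀ u : Fin n → ℂ, ‖u - x‖ ≤ A * δ → F (Fin.cons (q k) u) ≠ 0 := by
        intro k hk u hu hFu
        have huR : ‖u‖ ≤ R + A := by
          have := norm_le_insert' u x
          nlinarith
        obtain ⟨s, hs, hus⟩ := hTcov (a (b, k)) u hFu huR
        refine (hfar (Fin.cons (q k) s) (Finset.mem_union_left _ ?_)).not_ge ?_
        · exact Finset.mem_biUnion.2 ⟨(b, k), Finset.mk_mem_product hb
            (Finset.mem_range.2 (Nat.lt_succ_of_le hk)), Finset.mem_image_of_mem _ hs⟩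
        · rw [hzc]
          refine Fin.norm_cons_sub_cons_le ((hwq k hk).trans ?_) ?_
          · gcongr
            linarith
          · have := norm_sub_le_norm_sub_add_norm_sub x u s
            rw [norm_sub_rev x u] at this
            nlinarith
      have hline : ∀ t : ℂ, ‖t - w‖ ≤ A * δ → F (Fin.cons t y) ≠ 0 := by
        intro t ht hFt
        have hpy : p y ≠ 0 := by
          intro h
          refine hslice 0 (Nat.zero_le d) y ?_ (by rw [hp, h, Polynomial.eval_zero])
          rw [norm_sub_rev]
          refine hxy.trans (le_mul_of_one_le_left hδ.le (le_trans ?_ hMA))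
          rw [hM]
          have : (0 : ℝ) ≤ d := by positivity
          linarith
        refine (hfar (Fin.cons t y) (Finset.mem_union_right _ ?_)).not_ge ?_
        · refine Finset.mem_biUnion.2 ⟨y, hy, Finset.mem_image_of_mem _ ?_⟩
          rw [Multiset.mem_toFinset, Polynomial.mem_roots hpy, Polynomial.IsRoot, ← hp, hFt]
        · rw [hzc]
          refine Fin.norm_cons_sub_cons_le ?_ (hxy.trans ?_)
          · rw [norm_sub_rev]
            refine ht.trans ?_
            gcongr
            linarith
          · exact le_mul_of_one_le_left hδ.le (by linarith)
      refine hF.ne_zero_of_slices hδ (zero_lt_one.trans_le hρ1) hsmall hsmall' w y (x - y) hsep hwq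
        (fun k hk t ht => hline _ ?_) (fun k hk t ht => hslice k hk _ ?_) ?_
      · have e : q 0 + t * (q k - q 0) - w = t * ((w - q 0) - (w - q k)) - (w - q 0) := by ring
        have h0 := hwq 0 (Nat.zero_le d)
        have h1 := (norm_sub_le (w - q 0) (w - q k)).trans (add_le_add h0 (hwq k hk))
        rw [e]
        refine (norm_sub_le _ _).trans ?_
        rw [norm_mul]
        calc _ ≤ ρ * (M * δ + M * δ) + M * δ := by gcongr
          _ = A * δ := by rw [hA]; ring
      · have e : y + t • (x - y) - x = (t - 1) • (x - y) := by
          rw [sub_smul, one_smul]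
          abel
        have h1 := norm_sub_le t 1
        rw [norm_one] at h1
        rw [e, norm_smul]
        refine mul_le_mul (h1.trans ?_) hxy (norm_nonneg _) hA0
        have : (2 : ℝ) ≤ M := by
          rw [hM]
          have : (0 : ℝ) ≤ d := by positivity
          linarith
        rw [hA]
        nlinarith
      · rw [add_sub_cancel, ← hzc, hz]

lemma MvPolynomial.isPolyOnLines_eval {n : ℕ} (f : MvPolynomial (Fin n) ℂ) :
    IsPolyOnLines f.totalDegree fun x => MvPolynomial.eval x f := by
  intro x v
  refine ⟨MvPolynomial.aeval (fun i => Polynomial.X * Polynomial.C (v i) + Polynomial.C (x i)) f,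
    ?_, fun t => ?_⟩
  · simpa using MvPolynomial.aeval_natDegree_le (m := f.totalDegree) (n := 1) f le_rfl _ fun i => by
      compute_degree
  · rw [← Polynomial.coe_evalRingHom, MvPolynomial.aeval_def, MvPolynomial.hom_eval₂]
    change MvPolynomial.eval₂ (RingHom.id ℂ) (x + t • v) f = _
    congr 1
    · ext z
      simp
    · ext i
      simp [add_comm, mul_comm t]

lemma EuclideanSpace.norm_le_card_mul {n : ℕ} (x : EuclideanSpace ℂ (Fin n)) {r : ℝ}
    (h : ∀ i, ‖x i‖ ≤ r) : ‖x‖ ≤ n * r := by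
  rcases Nat.eq_zero_or_pos n with rfl | hn
  · simp [Subsingleton.elim x 0]
  have hr : 0 ≤ r := (norm_nonneg _).trans (h ⟨0, hn⟩)
  rw [EuclideanSpace.norm_eq]
  refine Real.sqrt_le_iff.2 ⟨by positivity, ?_⟩
  have hn1 : (1 : ℝ) ≤ n := by exact_mod_cast hn
  calc ∑ i, ‖x i‖ ^ 2 ≤ ∑ _i : Fin n, r ^ 2 := by
        gcongr with i
        exact h i
    _ = n * r ^ 2 := by simp
    _ ≤ (n * r) ^ 2 := by
        rw [mul_pow]
        gcongr
        nlinarith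

lemma MvPolynomial.exists_finset_cover_zeros {n : ℕ} (hn : 1 ≤ n) {f : MvPolynomial (Fin n) ℂ}
    (hf : f ≠ 0) (R : ℝ) :
    ∃ C K : ℝ, 1 ≤ C ∧ 1 ≤ K ∧ ∀ δ : ℝ, 0 < δ → δ ≤ 1 →
      ∃ S : Finset (EuclideanSpace ℂ (Fin n)), (S.card : ℝ) * δ ^ (2 * n - 2) ≤ C ∧
        ∀ z : EuclideanSpace ℂ (Fin n), MvPolynomial.eval (fun i => z i) f = 0 → ‖z‖ ≤ R →
          ∃ s ∈ S, ‖z - s‖ ≤ K * δ := by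
  classical
  obtain ⟨C, K, hC, hK, h⟩ := IsPolyOnLines.exists_finset_cover_zeros n f.totalDegree R
  have hf0 : ∃ x, MvPolynomial.eval x f ≠ 0 := by
    by_contra! h0
    exact hf (MvPolynomial.funext fun x => by rw [h0, map_zero])
  refine ⟨C + 1, n * K + 1, by linarith, by nlinarith [Nat.cast_nonneg (α := ℝ) n],
    fun δ hδ hδ1 => ?_⟩
  obtain ⟨S, hS, hcov⟩ := h _ f.isPolyOnLines_eval hf0 δ hδ hδ1
  refine ⟨S.image (WithLp.toLp 2), ?_, fun z hz hzR => ?_⟩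
  · have hpow : δ ^ (2 * n) = δ ^ (2 * n - 2) * δ ^ 2 := by
      rw [← pow_add]
      congr 1
      omega
    rw [hpow, ← mul_assoc] at hS
    have hS' := le_of_mul_le_mul_right hS (by positivity)
    calc _ ≤ (S.card : ℝ) * δ ^ (2 * n - 2) := by
          gcongr
          exact Finset.card_image_le
      _ ≤ _ := by linarith
  · have hzR' : ‖(fun i => z i : Fin n → ℂ)‖ ≤ R :=
      (pi_norm_le_iff_of_nonneg ((norm_nonneg _).trans hzR)).2
        fun i => (PiLp.norm_apply_le z i).trans hzR
    obtain ⟨s, hs, hzs⟩ := hcov _ hz hzR'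
    refine ⟨_, Finset.mem_image_of_mem _ hs, ?_⟩
    have := EuclideanSpace.norm_le_card_mul (z - WithLp.toLp 2 s) (r := K * δ)
      fun i => (norm_le_pi_norm ((fun i => z i : Fin n → ℂ) - s) i).trans hzs
    linarith

lemma le_capacityKernel {n : ℕ} {σ : ℝ} (hσ : 0 < σ) {z ξ : EuclideanSpace ℂ (Fin n)} {r : ℝ}
    (hr1 : r ≤ 1) (h : ‖z - ξ‖ ≤ r) :
    ENNReal.ofReal (|Real.log r| ^ σ / r ^ (2 * n - 2)) ≤ capacityKernel n σ z ξ := by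
  rw [capacityKernel]
  split_ifs with hzξ
  · exact le_top
  have hpos : 0 < ‖z - ξ‖ := norm_pos_iff.2 (sub_ne_zero.2 hzξ)
  have hlog : |Real.log r| ≤ |Real.log ‖z - ξ‖| := by
    rw [abs_of_nonpos (Real.log_nonpos (hpos.le.trans h) hr1),
      abs_of_nonpos (Real.log_nonpos hpos.le (h.trans hr1))]
    exact neg_le_neg (Real.log_le_log hpos h)
  gcongr

/-- Lower bound for the energy of a probability measure carried by finitely many closed balls of
radius `r`: when `τ` times the number of balls is at most `1 / 2`, the balls of measure at least
`τ` carry at least half of the mass. -/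
lemma mul_inv_two_le_lintegral_lintegral {E : Type*} [NormedAddCommGroup E] [MeasurableSpace E]
    [BorelSpace E] (μ : Measure E) [IsProbabilityMeasure μ] (k : E → E → ℝ≥0∞) {r : ℝ}
    {κ τ : ℝ≥0∞} (hk : ∀ z ξ, ‖z - ξ‖ ≤ 2 * r → κ ≤ k z ξ) (S : Finset E)
    (hS : S.card * τ ≤ 2⁻¹) (hcov : μ (⋃ s ∈ S, Metric.closedBall s r)ᶜ = 0) :
    κ * τ * 2⁻¹ ≤ ∫⁻ z, ∫⁻ ξ, k z ξ ∂μ ∂μ := by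
  classical
  set G : Set E := ⋃ s ∈ S.filter fun s => τ ≤ μ (Metric.closedBall s r), Metric.closedBall s r
    with hG
  have hGm : MeasurableSet G :=
    Finset.measurableSet_biUnion _ fun s _ => Metric.isClosed_closedBall.measurableSet
  have hGc : μ Gᶜ ≤ 2⁻¹ := by
    have hsub : Gᶜ ⊆ (⋃ s ∈ S, Metric.closedBall s r)ᶜ ∪
        ⋃ s ∈ S.filter fun s => ¬ τ ≤ μ (Metric.closedBall s r), Metric.closedBall s r := by
      intro z hz
      by_cases hzS : z ∈ ⋃ s ∈ S, Metric.closedBall s r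
      · right
        simp only [hG, Set.mem_compl_iff, Set.mem_iUnion, Finset.mem_filter, not_exists] at hz
        simp only [Set.mem_iUnion] at hzS
        obtain ⟨s, hs, hzs⟩ := hzS
        simp only [Set.mem_iUnion, Finset.mem_filter]
        exact ⟨s, ⟨hs, fun h => hz s ⟨hs, h⟩ hzs⟩, hzs⟩
      · exact Or.inl hzS
    calc μ Gᶜ ≤ 0 + ∑ s ∈ S.filter fun s => ¬ τ ≤ μ (Metric.closedBall s r),
          μ (Metric.closedBall s r) := by
          refine (measure_mono hsub).trans ((measure_union_le _ _).trans ?_)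
          rw [hcov]
          gcongr
          exact measure_biUnion_finset_le _ _
      _ ≤ ∑ _s ∈ S.filter fun s => ¬ τ ≤ μ (Metric.closedBall s r), τ := by
          rw [zero_add]
          exact Finset.sum_le_sum fun s hs => (not_le.1 (Finset.mem_filter.1 hs).2).le
      _ ≤ S.card * τ := by
          rw [Finset.sum_const, nsmul_eq_mul]
          gcongr
          exact Finset.filter_subset _ _
      _ ≤ 2⁻¹ := hS
  have hGμ : 2⁻¹ ≤ μ G := by
    have h1 : μ G + μ Gᶜ = 1 := prob_add_prob_compl hGm
    rw [← ENNReal.one_sub_inv_two, ← h1]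
    exact tsub_le_iff_right.2 (by gcongr)
  calc κ * τ * 2⁻¹ ≤ κ * τ * μ G := by gcongr
    _ = ∫⁻ _z in G, κ * τ ∂μ := by rw [setLIntegral_const]
    _ ≤ ∫⁻ z in G, ∫⁻ ξ, k z ξ ∂μ ∂μ := by
        refine setLIntegral_mono' hGm fun z hz => ?_
        simp only [hG, Set.mem_iUnion, Finset.mem_filter] at hz
        obtain ⟨s, ⟨-, hs⟩, hzs⟩ := hz
        calc κ * τ ≤ κ * μ (Metric.closedBall s r) := by gcongr
          _ = ∫⁻ _ξ in Metric.closedBall s r, κ ∂μ := by rw [setLIntegral_const]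
          _ ≤ ∫⁻ ξ in Metric.closedBall s r, k z ξ ∂μ := by
              refine setLIntegral_mono' Metric.isClosed_closedBall.measurableSet fun ξ hξ => ?_
              refine hk z ξ ?_
              rw [mem_closedBall_iff_norm] at hzs hξ
              have := norm_sub_le_norm_sub_add_norm_sub z s ξ
              rw [norm_sub_rev s ξ] at this
              linarith
          _ ≤ ∫⁻ ξ, k z ξ ∂μ := setLIntegral_le_lintegral _ _
    _ ≤ _ := setLIntegral_le_lintegral _ _

theorem analytic_set_zero_capacity (n : ℕ) (hn : 2 ≤ n) (σ : ℝ) (hσ : 0 < σ)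
    (f : MvPolynomial (Fin n) ℂ) (hf : f ≠ 0)
    (c : EuclideanSpace ℂ (Fin n)) (R : ℝ)
    (μ : Measure (EuclideanSpace ℂ (Fin n))) (hμ : IsProbabilityMeasure μ)
    (hsupp : μ (({z | MvPolynomial.eval (fun i => z i) f = 0} ∩ Metric.closedBall c R)ᶜ) = 0) :
    ∫⁻ z, ∫⁻ ξ, capacityKernel n σ z ξ ∂μ ∂μ = ⊤ := by
  obtain ⟨C, K, hC, hK, hcover⟩ :=
    MvPolynomial.exists_finset_cover_zeros (one_le_two.trans hn) hf (‖c‖ + R)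
  have hC0 : 0 < C := zero_lt_one.trans_le hC
  have hK0 : 0 < K := zero_lt_one.trans_le hK
  set m := 2 * n - 2
  refine ENNReal.eq_top_of_forall_nnreal_le fun x => ?_
  obtain ⟨L, hL, hLx⟩ := ((Filter.eventually_ge_atTop 0).and
    ((tendsto_rpow_atTop hσ).eventually_ge_atTop (x * (2 * K) ^ m * (2 * C) * 2))).exists
  set r := Real.exp (-L) with hr
  have hr0 : 0 < r := Real.exp_pos _
  have hr1 : r ≤ 1 := Real.exp_le_one_iff.2 (by linarith)
  have hlog : |Real.log r| = L := by rw [hr, Real.log_exp, abs_neg, abs_of_nonneg hL]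
  set δ := r / (2 * K) with hδ
  have hδ0 : 0 < δ := by positivity
  have hrδ : r = 2 * (K * δ) := by
    rw [hδ]
    field_simp
  obtain ⟨S, hS, hcov⟩ := hcover δ hδ0 ((div_le_one (by positivity)).2 (by linarith))
  have hτ : (S.card : ℝ≥0∞) * ENNReal.ofReal (δ ^ m / (2 * C)) ≤ 2⁻¹ := by
    have h2 : (2⁻¹ : ℝ≥0∞) = ENNReal.ofReal 2⁻¹ := by
      rw [ENNReal.ofReal_inv_of_pos two_pos, ENNReal.ofReal_ofNat]
    rw [h2, ← ENNReal.ofReal_natCast, ← ENNReal.ofReal_mul (Nat.cast_nonneg _)]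
    refine ENNReal.ofReal_le_ofReal ?_
    rw [← mul_div_assoc, div_le_iff₀ (by positivity)]
    linarith
  have hmain := mul_inv_two_le_lintegral_lintegral μ (capacityKernel n σ) (r := K * δ)
    (κ := ENNReal.ofReal (|Real.log r| ^ σ / r ^ m))
    (fun z ξ h => le_capacityKernel hσ hr1 (h.trans_eq hrδ.symm)) S hτ <| by
      refine measure_mono_null (Set.compl_subset_compl.2 ?_) hsupp
      rintro z ⟨hz, hzc⟩
      rw [mem_closedBall_iff_norm] at hzc
      have hzR : ‖z‖ ≤ ‖c‖ + R := by
        have := norm_le_insert' z c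
        linarith
      obtain ⟨s, hs, hzs⟩ := hcov z hz hzR
      exact Set.mem_biUnion hs (mem_closedBall_iff_norm.2 hzs)
  refine le_trans ?_ hmain
  have h2 : (2⁻¹ : ℝ≥0∞) = ENNReal.ofReal 2⁻¹ := by
    rw [ENNReal.ofReal_inv_of_pos two_pos, ENNReal.ofReal_ofNat]
  rw [h2, ← ENNReal.ofReal_mul (by positivity), ← ENNReal.ofReal_mul (by positivity),
    ← ENNReal.ofReal_coe_nnreal]
  refine ENNReal.ofReal_le_ofReal ?_
  have e : L ^ σ / r ^ m * (δ ^ m / (2 * C)) * 2⁻¹ = L ^ σ / ((2 * K) ^ m * (2 * C) * 2) := by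
    rw [hδ, div_pow]
    field_simp
  rw [hlog, e, le_div_iff₀ (by positivity)]
  linarith
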